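/- r-th level scaled-cancellation recursion for the third T-sequence: in the r-th level interpolating setup with p_{k−1}q_{k−1} > p_kq_k for all 1 ≤ k ≤ r+1, for every k₁ ∈ {1,…,r}: Σ_{i₁=1}^{l} Σ_{i₂=1}^{l} β_{i₁} ‖y^{(i₂)}‖₂ (√t/√(p_{k₁}q_{k₁}−p_{k₁+1}q_{k₁+1})) T^{(p,q)}_{k₁+1,3}(i₁,i₂) = Σ_{i₁=1}^{l} Σ_{i₂=1}^{l} β_{i₁} ‖y^{(i₂)}‖₂ (√t/√(p_{k₁−1}q_{k₁−1}−p_{k₁}q_{k₁})) T^{(p,q)}_{k₁,3}(i₁,i₂) − t s β² (𝔪_{k₁} − 𝔪_{k₁+1}) E_{G,𝒰_{r+1}}⟨‖x^{(i₁)}‖₂‖x^{(p₁)}‖₂‖y^{(i₂)}‖₂‖y^{(p₂)}‖₂⟩_{γ_{k₁+1}^{(r)}}. -/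

import Mathlib

set_option linter.unusedVariables false

open MeasureTheory Real

namespace SFLR

noncomputable section

/-- The sample space of one group `𝒰_k = (u^{(4,k)}, u^{(2,k)}, h^{(k)})`. -/
abbrev Us (m n : ℕ) : Type := ℝ × (Fin m → ℝ) × (Fin n → ℝ)

/-- Standard Gaussian measure on `ℝ`. -/
def stdG : Measure ℝ := ProbabilityTheory.gaussianReal 0 1

/-- i.i.d. standard Gaussian vector measure. -/
def gVec (d : ℕ) : Measure (Fin d → ℝ) := Measure.pi fun _ => stdG

/-- i.i.d. standard Gaussian matrix measure. -/
def gMat (m n : ℕ) : Measure (Fin m → Fin n → ℝ) := Measure.pi fun _ => gVec n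

/-- Law of one group `𝒰_k`. -/
def muU (m n : ℕ) : Measure (Us m n) := stdG.prod ((gVec m).prod (gVec n))

/-- Joint law of `(G, (𝒰_k)_{k=1}^{r+1})`; the `k`-th group `𝒰_k` is coordinate `k-1`. -/
def muAll (r m n : ℕ) : Measure ((Fin m → Fin n → ℝ) × (Fin (r+1) → Us m n)) :=
  (gMat m n).prod (Measure.pi fun _ : Fin (r+1) => muU m n)

/-- Euclidean norm. -/
def nrm2 {d : ℕ} (v : Fin d → ℝ) : ℝ := Real.sqrt (∑ i, v i ^ 2)

/-- Euclidean inner product. -/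
def dotv {d : ℕ} (a b : Fin d → ℝ) : ℝ := ∑ i, a i * b i

variable {m n l : ℕ}

/-- The `r`-th level interpolating exponent `D₀^{(i₁,i₂)}`; the factor `ε` multiplies the
`u^{(4,k)}`-terms (`ε = 1` gives `D₀`, `ε = 0` gives `D_{0,S}`). -/
def D0R (r : ℕ) (ε β s t : ℝ) (mv p q : ℕ → ℝ) (x : Fin l → Fin n → ℝ) (y : Fin l → Fin m → ℝ)
    (G : Fin m → Fin n → ℝ) (U : Fin (r+1) → Us m n) (i1 i2 : Fin l) : ℝ :=
  Real.sqrt t * (∑ j, ∑ k, y i2 j * (G j k * x i1 k))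
    + Real.sqrt (1 - t) * nrm2 (x i1) *
        (∑ j, y i2 j * (∑ k : Fin (r+1), Real.sqrt (p (k : ℕ) - p ((k : ℕ) + 1)) * (U k).2.1 j))
    + ε * (Real.sqrt t * nrm2 (x i1) * nrm2 (y i2) *
        (∑ k : Fin (r+1),
          Real.sqrt (p (k : ℕ) * q (k : ℕ) - p ((k : ℕ) + 1) * q ((k : ℕ) + 1)) * (U k).1))
    + Real.sqrt (1 - t) * nrm2 (y i2) *
        (∑ kk, (∑ k : Fin (r+1), Real.sqrt (q (k : ℕ) - q ((k : ℕ) + 1)) * (U k).2.2 kk) * x i1 kk)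

/-- `A^{(i₁,i₂)}`. -/
def AR (r : ℕ) (ε β s t : ℝ) (mv p q : ℕ → ℝ) (x : Fin l → Fin n → ℝ) (y : Fin l → Fin m → ℝ)
    (G : Fin m → Fin n → ℝ) (U : Fin (r+1) → Us m n) (i1 i2 : Fin l) : ℝ :=
  Real.exp (β * D0R r ε β s t mv p q x y G U i1 i2)

/-- `C^{(i₁)}`. -/
def CR (r : ℕ) (ε β s t : ℝ) (mv p q : ℕ → ℝ) (x : Fin l → Fin n → ℝ) (y : Fin l → Fin m → ℝ)
    (G : Fin m → Fin n → ℝ) (U : Fin (r+1) → Us m n) (i1 : Fin l) : ℝ :=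
  ∑ i2, AR r ε β s t mv p q x y G U i1 i2

/-- `Z`. -/
def ZR (r : ℕ) (ε β s t : ℝ) (mv p q : ℕ → ℝ) (x : Fin l → Fin n → ℝ) (y : Fin l → Fin m → ℝ)
    (G : Fin m → Fin n → ℝ) (U : Fin (r+1) → Us m n) : ℝ :=
  ∑ i1, CR r ε β s t mv p q x y G U i1 ^ s

/-- `ζ_k`: successively integrated partition functions, `ζ₀ = Z`,
`ζ_k = E_{𝒰_k} ζ_{k-1}^{𝔪_k/𝔪_{k-1}}`. -/
def zetaR (r : ℕ) (ε β s t : ℝ) (mv p q : ℕ → ℝ) (x : Fin l → Fin n → ℝ)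
    (y : Fin l → Fin m → ℝ) (G : Fin m → Fin n → ℝ) : ℕ → (Fin (r+1) → Us m n) → ℝ
  | 0, U => ZR r ε β s t mv p q x y G U
  | k+1, U =>
      if h : k < r + 1 then
        ∫ u, zetaR r ε β s t mv p q x y G k (Function.update U ⟨k, h⟩ u) ^ (mv (k+1) / mv k)
          ∂ muU m n
      else 0

/-- The `r`-th level interpolating function `ψ`. -/
def psiR (r : ℕ) (ε β s t : ℝ) (mv p q : ℕ → ℝ) (x : Fin l → Fin n → ℝ)
    (y : Fin l → Fin m → ℝ) : ℝ :=
  ∫ ω, (β * |s| * Real.sqrt (n : ℝ) * mv r)⁻¹ *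
      Real.log (zetaR r ε β s t mv p q x y ω.1 r ω.2) ∂ muAll r m n

/-- The operator `Φ_{𝒰_k}` (for `k ≥ 1`). -/
def PhiR (r : ℕ) (ε β s t : ℝ) (mv p q : ℕ → ℝ) (x : Fin l → Fin n → ℝ)
    (y : Fin l → Fin m → ℝ) (k : ℕ)
    (f : (Fin m → Fin n → ℝ) → (Fin (r+1) → Us m n) → ℝ) :
    (Fin m → Fin n → ℝ) → (Fin (r+1) → Us m n) → ℝ :=
  fun G U =>
    if h : k - 1 < r + 1 then
      (∫ u, zetaR r ε β s t mv p q x y G (k-1) (Function.update U ⟨k-1, h⟩ u) ^ (mv k / mv (k-1))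
          * f G (Function.update U ⟨k-1, h⟩ u) ∂ muU m n) /
        zetaR r ε β s t mv p q x y G k U
    else 0

/-- `Φ_{𝒰_hi} ∘ ⋯ ∘ Φ_{𝒰_lo}` (identity when `hi < lo`). -/
def PhiUpToR (r : ℕ) (ε β s t : ℝ) (mv p q : ℕ → ℝ) (x : Fin l → Fin n → ℝ)
    (y : Fin l → Fin m → ℝ) (lo : ℕ) :
    ℕ → ((Fin m → Fin n → ℝ) → (Fin (r+1) → Us m n) → ℝ) →
      (Fin m → Fin n → ℝ) → (Fin (r+1) → Us m n) → ℝ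
  | 0, f => f
  | hi+1, f =>
      if hi + 1 < lo then f
      else PhiR r ε β s t mv p q x y (hi+1) (PhiUpToR r ε β s t mv p q x y lo hi f)

/-- `γ₀(i₁,i₂)`. -/
def gam0R (r : ℕ) (ε β s t : ℝ) (mv p q : ℕ → ℝ) (x : Fin l → Fin n → ℝ)
    (y : Fin l → Fin m → ℝ) (i1 i2 : Fin l) :
    (Fin m → Fin n → ℝ) → (Fin (r+1) → Us m n) → ℝ :=
  fun G U =>
    CR r ε β s t mv p q x y G U i1 ^ s / ZR r ε β s t mv p q x y G U *
      (AR r ε β s t mv p q x y G U i1 i2 / CR r ε β s t mv p q x y G U i1)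

/-- The measure `γ_{k₁+1}^{(r)}`. -/
def gamR (r : ℕ) (ε β s t : ℝ) (mv p q : ℕ → ℝ) (x : Fin l → Fin n → ℝ)
    (y : Fin l → Fin m → ℝ) (k1 : ℕ) (i1 i2 pp1 pp2 : Fin l) :
    (Fin m → Fin n → ℝ) → (Fin (r+1) → Us m n) → ℝ :=
  PhiUpToR r ε β s t mv p q x y (k1+1) r
    (fun G U =>
      PhiUpToR r ε β s t mv p q x y 1 k1 (gam0R r ε β s t mv p q x y i1 i2) G U *
        PhiUpToR r ε β s t mv p q x y 1 k1 (gam0R r ε β s t mv p q x y pp1 pp2) G U)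

/-- The measure `γ₀₁^{(r)}`. -/
def gam01R (r : ℕ) (ε β s t : ℝ) (mv p q : ℕ → ℝ) (x : Fin l → Fin n → ℝ)
    (y : Fin l → Fin m → ℝ) (i1 i2 : Fin l) :
    (Fin m → Fin n → ℝ) → (Fin (r+1) → Us m n) → ℝ :=
  PhiUpToR r ε β s t mv p q x y 1 r (gam0R r ε β s t mv p q x y i1 i2)

/-- The measure `γ₀₂^{(r)}`. -/
def gam02R (r : ℕ) (ε β s t : ℝ) (mv p q : ℕ → ℝ) (x : Fin l → Fin n → ℝ)
    (y : Fin l → Fin m → ℝ) (i1 i2 p2 : Fin l) :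
    (Fin m → Fin n → ℝ) → (Fin (r+1) → Us m n) → ℝ :=
  PhiUpToR r ε β s t mv p q x y 1 r
    (fun G U =>
      gam0R r ε β s t mv p q x y i1 i2 G U * gam0R r ε β s t mv p q x y i1 p2 G U)

/-- `E_{G,𝒰_{r+1}} ⟨f⟩_{γ_{k₁+1}^{(r)}}`. -/
def EBrR (r : ℕ) (ε β s t : ℝ) (mv p q : ℕ → ℝ) (x : Fin l → Fin n → ℝ)
    (y : Fin l → Fin m → ℝ) (k1 : ℕ) (f : Fin l → Fin l → Fin l → Fin l → ℝ) : ℝ :=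
  ∫ ω, (∑ i1, ∑ i2, ∑ pp1, ∑ pp2,
      f i1 i2 pp1 pp2 * gamR r ε β s t mv p q x y k1 i1 i2 pp1 pp2 ω.1 ω.2) ∂ muAll r m n

/-- `E_{G,𝒰_{r+1}} ⟨f⟩_{γ₀₁^{(r)}}`. -/
def EB01R (r : ℕ) (ε β s t : ℝ) (mv p q : ℕ → ℝ) (x : Fin l → Fin n → ℝ)
    (y : Fin l → Fin m → ℝ) (f : Fin l → Fin l → ℝ) : ℝ :=
  ∫ ω, (∑ i1, ∑ i2, f i1 i2 * gam01R r ε β s t mv p q x y i1 i2 ω.1 ω.2) ∂ muAll r m n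

/-- `E_{G,𝒰_{r+1}} ⟨f⟩_{γ₀₂^{(r)}}`. -/
def EB02R (r : ℕ) (ε β s t : ℝ) (mv p q : ℕ → ℝ) (x : Fin l → Fin n → ℝ)
    (y : Fin l → Fin m → ℝ) (f : Fin l → Fin l → Fin l → ℝ) : ℝ :=
  ∫ ω, (∑ i1, ∑ i2, ∑ p2, f i1 i2 p2 * gam02R r ε β s t mv p q x y i1 i2 p2 ω.1 ω.2)
    ∂ muAll r m n

/-- `E_{G,𝒰_{r+1}} ⟨‖x^{(i₁)}‖‖x^{(p₁)}‖‖y^{(i₂)}‖‖y^{(p₂)}‖⟩_{γ_{k₁+1}^{(r)}}`. -/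
def EXR (r : ℕ) (ε β s t : ℝ) (mv p q : ℕ → ℝ) (x : Fin l → Fin n → ℝ)
    (y : Fin l → Fin m → ℝ) (k1 : ℕ) : ℝ :=
  EBrR r ε β s t mv p q x y k1
    (fun i1 i2 pp1 pp2 => nrm2 (x i1) * nrm2 (x pp1) * nrm2 (y i2) * nrm2 (y pp2))

/-- The corrected interpolating function `ψ₁`. -/
def psi1R (r : ℕ) (ε β s t : ℝ) (mv p q : ℕ → ℝ) (x : Fin l → Fin n → ℝ)
    (y : Fin l → Fin m → ℝ) : ℝ :=
  -(Real.sign s * s * β / (2 * Real.sqrt (n : ℝ))) *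
      (∑ k ∈ Finset.range (r+1),
        mv (k+1) * (p k * q k * EXR r ε β s t mv p q x y k
          - p (k+1) * q (k+1) * EXR r ε β s t mv p q x y (k+1)))
    + psiR r ε β s t mv p q x y

/-- The component `u_j^{(2,k)}`. -/
def u2c {r m n : ℕ} (U : Fin (r+1) → Us m n) (k : ℕ) (j : Fin m) : ℝ :=
  if h : k - 1 < r + 1 then (U ⟨k-1, h⟩).2.1 j else 0

/-- The scalar `u^{(4,k)}`. -/
def u4c {r m n : ℕ} (U : Fin (r+1) → Us m n) (k : ℕ) : ℝ :=
  if h : k - 1 < r + 1 then (U ⟨k-1, h⟩).1 else 0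

/-- `u^{(i₁,3,k)} = (h^{(k)})ᵀ x^{(i₁)} / ‖x^{(i₁)}‖₂`. -/
def u3c {r m n l : ℕ} (x : Fin l → Fin n → ℝ) (U : Fin (r+1) → Us m n) (k : ℕ)
    (i1 : Fin l) : ℝ :=
  if h : k - 1 < r + 1 then dotv (U ⟨k-1, h⟩).2.2 (x i1) / nrm2 (x i1) else 0

/-- The nested conditional expectations
`E_{𝒰_v}(ζ_{v-1}^{𝔪_v/𝔪_{v-1}-1} ⋯ E_{𝒰₁}(ζ₀^{𝔪₁/𝔪₀-1} g) ⋯)`. -/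
def nestR (r : ℕ) (ε β s t : ℝ) (mv p q : ℕ → ℝ) (x : Fin l → Fin n → ℝ)
    (y : Fin l → Fin m → ℝ) (g : (Fin m → Fin n → ℝ) → (Fin (r+1) → Us m n) → ℝ) :
    ℕ → (Fin m → Fin n → ℝ) → (Fin (r+1) → Us m n) → ℝ
  | 0 => g
  | v+1 => fun G U =>
      if h : v < r + 1 then
        ∫ u, zetaR r ε β s t mv p q x y G v (Function.update U ⟨v, h⟩ u) ^
              (mv (v+1) / mv v - 1) *
            nestR r ε β s t mv p q x y g v G (Function.update U ⟨v, h⟩ u) ∂ muU m n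
      else 0

/-- `T^p_{k,1,j}(i₁,i₂)` at the `r`-th level. -/
def TpR (r : ℕ) (ε β s t : ℝ) (mv p q : ℕ → ℝ) (x : Fin l → Fin n → ℝ)
    (y : Fin l → Fin m → ℝ) (k : ℕ) (j : Fin m) (i1 i2 : Fin l) : ℝ :=
  ∫ ω, (zetaR r ε β s t mv p q x y ω.1 r ω.2)⁻¹ *
      nestR r ε β s t mv p q x y
        (fun G U => CR r ε β s t mv p q x y G U i1 ^ (s - 1) *
          AR r ε β s t mv p q x y G U i1 i2 * y i2 j * u2c U k j) r ω.1 ω.2 ∂ muAll r m n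

/-- `T^q_{k,2}(i₁,i₂)` at the `r`-th level. -/
def TqR (r : ℕ) (ε β s t : ℝ) (mv p q : ℕ → ℝ) (x : Fin l → Fin n → ℝ)
    (y : Fin l → Fin m → ℝ) (k : ℕ) (i1 i2 : Fin l) : ℝ :=
  ∫ ω, (zetaR r ε β s t mv p q x y ω.1 r ω.2)⁻¹ *
      nestR r ε β s t mv p q x y
        (fun G U => CR r ε β s t mv p q x y G U i1 ^ (s - 1) *
          AR r ε β s t mv p q x y G U i1 i2 * u3c x U k i1) r ω.1 ω.2 ∂ muAll r m n

/-- `T^{(p,q)}_{k,3}(i₁,i₂)` at the `r`-th level. -/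
def TpqR (r : ℕ) (ε β s t : ℝ) (mv p q : ℕ → ℝ) (x : Fin l → Fin n → ℝ)
    (y : Fin l → Fin m → ℝ) (k : ℕ) (i1 i2 : Fin l) : ℝ :=
  ∫ ω, (zetaR r ε β s t mv p q x y ω.1 r ω.2)⁻¹ *
      nestR r ε β s t mv p q x y
        (fun G U => CR r ε β s t mv p q x y G U i1 ^ (s - 1) *
          AR r ε β s t mv p q x y G U i1 i2 * u4c U k) r ω.1 ω.2 ∂ muAll r m n



open Filter Topology

/-- all exponential moments of the norm are finite -/
def ExpInt {E : Type*} [MeasurableSpace E] [NormedAddCommGroup E] (μ : Measure E) : Prop :=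
  ∀ K : ℝ, 0 ≤ K → Integrable (fun u => Real.exp (K * ‖u‖)) μ

instance : IsProbabilityMeasure stdG := by unfold stdG; infer_instance
instance (d : ℕ) : IsProbabilityMeasure (gVec d) := by unfold gVec; infer_instance
instance (m n : ℕ) : IsProbabilityMeasure (gMat m n) := by unfold gMat; infer_instance
instance (m n : ℕ) : IsProbabilityMeasure (muU m n) := by unfold muU; infer_instance
instance (r m n : ℕ) : IsProbabilityMeasure (muAll r m n) := by unfold muAll; infer_instance

lemma expInt_stdG : ExpInt stdG := by
  intro K hK
  have h1 : Integrable (fun u : ℝ => Real.exp (K * u)) stdG :=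
    ProbabilityTheory.integrable_exp_mul_gaussianReal K
  have h2 : Integrable (fun u : ℝ => Real.exp ((-K) * u)) stdG :=
    ProbabilityTheory.integrable_exp_mul_gaussianReal (-K)
  refine (h1.add h2).mono' (by fun_prop) (ae_of_all _ fun u => ?_)
  rw [Real.norm_eq_abs, abs_of_pos (Real.exp_pos _), Real.norm_eq_abs]
  simp only [Pi.add_apply]
  rcases abs_cases u with ⟨h, _⟩ | ⟨h, _⟩ <;> rw [h]
  · linarith [Real.exp_pos (-K * u)]
  · have : K * -u = -K * u := by ring
    rw [this]
    linarith [Real.exp_pos (K * u)]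

lemma ExpInt.pi {ι : Type*} [Fintype ι] {E : Type*} [NormedAddCommGroup E] [MeasurableSpace E]
    [BorelSpace E] [SecondCountableTopology E] {μ : Measure E} [IsProbabilityMeasure μ]
    (h : ExpInt μ) : ExpInt (Measure.pi fun _ : ι => μ) := by
  intro K hK
  have h1 : Integrable (fun v : ι → E => ∏ i, Real.exp (K * ‖v i‖)) (Measure.pi fun _ : ι => μ) :=
    Integrable.fintype_prod (fun _ => h K hK)
  refine h1.mono' (by fun_prop) (ae_of_all _ fun u => ?_)
  rw [Real.norm_eq_abs, abs_of_pos (Real.exp_pos _), ← Real.exp_sum, Real.exp_le_exp,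
    ← Finset.mul_sum]
  refine mul_le_mul_of_nonneg_left ?_ hK
  refine (pi_norm_le_iff_of_nonneg (Finset.sum_nonneg fun i _ => norm_nonneg _)).2 fun i => ?_
  exact Finset.single_le_sum (f := fun i => ‖u i‖) (fun i _ => norm_nonneg _) (Finset.mem_univ i)

lemma ExpInt.prod {E F : Type*} [NormedAddCommGroup E] [MeasurableSpace E]
    [BorelSpace E] [SecondCountableTopology E] [NormedAddCommGroup F] [MeasurableSpace F]
    [BorelSpace F] [SecondCountableTopology F] {μ : Measure E} [IsProbabilityMeasure μ]
    {ν : Measure F} [IsProbabilityMeasure ν]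
    (h : ExpInt μ) (h' : ExpInt ν) : ExpInt (μ.prod ν) := by
  intro K hK
  have h1 := (h K hK).mul_prod (h' K hK)
  refine h1.mono' (by fun_prop) (ae_of_all _ fun u => ?_)
  rw [Real.norm_eq_abs, abs_of_pos (Real.exp_pos _), ← Real.exp_add, Real.exp_le_exp, ← mul_add]
  refine mul_le_mul_of_nonneg_left ?_ hK
  rw [Prod.norm_def]
  exact max_le (by linarith [norm_nonneg u.2]) (by linarith [norm_nonneg u.1])

lemma expInt_gVec (d : ℕ) : ExpInt (gVec d) := expInt_stdG.pi
lemma expInt_gMat (m n : ℕ) : ExpInt (gMat m n) := (expInt_gVec n).pi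
lemma expInt_muU (m n : ℕ) : ExpInt (muU m n) :=
  expInt_stdG.prod ((expInt_gVec m).prod (expInt_gVec n))
lemma expInt_muUs (r m n : ℕ) : ExpInt (Measure.pi fun _ : Fin (r+1) => muU m n) :=
  (expInt_muU m n).pi

/-- resampling one coordinate preserves the product measure -/
lemma map_update_pi {ι : Type*} [Fintype ι] [DecidableEq ι] {E : Type*} [MeasurableSpace E]
    (μ : Measure E) [IsProbabilityMeasure μ] (j : ι) :
    MeasurePreserving (fun z : (ι → E) × E => Function.update z.1 j z.2)
      ((Measure.pi fun _ : ι => μ).prod μ) (Measure.pi fun _ : ι => μ) := by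
  have hmeas : Measurable (fun z : (ι → E) × E => Function.update z.1 j z.2) := by
    rw [measurable_pi_iff]
    intro i
    by_cases hi : i = j
    · subst hi; simpa using measurable_snd
    · simp only [Function.update_of_ne hi]
      exact (measurable_pi_apply i).comp measurable_fst
  refine ⟨hmeas, ?_⟩
  symm
  refine Measure.pi_eq fun s hs => ?_
  rw [Measure.map_apply hmeas (MeasurableSet.univ_pi hs)]
  have : (fun z : (ι → E) × E => Function.update z.1 j z.2) ⁻¹' (Set.univ.pi s) =
      (Set.univ.pi (Function.update s j Set.univ)) ×ˢ (s j) := by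
    ext z
    simp only [Set.mem_preimage, Set.mem_pi, Set.mem_univ, true_implies, Set.mem_prod]
    constructor
    · intro h
      refine ⟨fun i => ?_, by simpa using h j⟩
      by_cases hi : i = j
      · subst hi; simp
      · simpa [Function.update_of_ne hi] using h i
    · rintro ⟨h1, h2⟩ i
      by_cases hi : i = j
      · subst hi; simpa using h2
      · simpa [Function.update_of_ne hi] using h1 i
  rw [this, Measure.prod_prod, Measure.pi_pi, ← Finset.mul_prod_erase _ _ (Finset.mem_univ j),
    ← Finset.mul_prod_erase _ (fun i => μ (s i)) (Finset.mem_univ j)]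
  simp only [Function.update_self, measure_univ, one_mul]
  rw [mul_comm]
  congr 1
  refine Finset.prod_congr rfl fun i hi => ?_
  rw [Function.update_of_ne (Finset.ne_of_mem_erase hi)]

/-- one-dimensional Gaussian integration by parts -/
lemma stein_one {f f' : ℝ → ℝ} (hf : ∀ x, HasDerivAt f (f' x) x)
    (h0 : Integrable f stdG) (h1 : Integrable (fun x => x * f x) stdG) (h2 : Integrable f' stdG) :
    ∫ x, x * f x ∂stdG = ∫ x, f' x ∂stdG := by
  let g : ℝ → ℝ := fun x => ProbabilityTheory.gaussianPDFReal 0 1 x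
  have hg : ∀ x, HasDerivAt g (-x * g x) x := by
    intro x
    have : g = fun x => (√(2 * π * ((1 : NNReal) : ℝ)))⁻¹ * Real.exp (-(x - 0) ^ 2 / (2 * ((1 : NNReal) : ℝ))) := rfl
    rw [this]
    have h : HasDerivAt (fun x : ℝ => -(x - 0) ^ 2 / (2 * ((1 : NNReal) : ℝ))) (-x) x := by
      have := ((((hasDerivAt_id x).sub_const 0).pow 2).neg).div_const (2 * ((1 : NNReal) : ℝ))
      refine HasDerivAt.congr_deriv this ?_
      simp
      ring
    refine HasDerivAt.congr_deriv (h.exp.const_mul (√(2 * π * ((1 : NNReal) : ℝ)))⁻¹) ?_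
    ring
  have key : ∀ φ : ℝ → ℝ, Integrable φ stdG → Integrable (fun x => φ x * g x) := by
    intro φ hφ
    rw [stdG, ProbabilityTheory.gaussianReal_of_var_ne_zero _ one_ne_zero,
      integrable_withDensity_iff_integrable_smul' (by fun_prop) (by simp [ProbabilityTheory.gaussianPDF])] at hφ
    refine hφ.congr (ae_of_all _ fun x => ?_)
    simp [g, ProbabilityTheory.toReal_gaussianPDF, mul_comm]
  have key2 : ∀ φ : ℝ → ℝ, ∫ x, φ x ∂stdG = ∫ x, φ x * g x := by
    intro φ
    rw [stdG, ProbabilityTheory.integral_gaussianReal_eq_integral_smul one_ne_zero]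
    refine integral_congr_ae (ae_of_all _ fun x => ?_)
    simp [g, mul_comm]
  rw [key2, key2]
  have := integral_mul_deriv_eq_deriv_mul_of_integrable (u := f) (v := g) (u' := f')
    (v' := fun x => -x * g x) (fun x _ => hf x) (fun x _ => hg x) ?_ ?_ ?_
  · have e : ∫ x, x * f x * g x = - ∫ x, f x * (-x * g x) := by
      rw [← integral_neg]; congr 1; ext x; ring
    rw [e, this, neg_neg]
  · refine ((key _ h1).neg).congr (ae_of_all _ fun x => ?_)
    simp; ring
  · exact key _ h2
  · exact key _ h0

variable {r : ℕ}

abbrev GM (m n : ℕ) : Type := Fin m → Fin n → ℝ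
abbrev UU (r m n : ℕ) : Type := Fin (r+1) → Us m n

/-- continuous with at most linear growth -/
def LinGr (f : GM m n → UU r m n → ℝ) : Prop :=
  Continuous (fun ω : GM m n × UU r m n => f ω.1 ω.2) ∧
    ∃ K : ℝ, 0 ≤ K ∧ ∀ G U, |f G U| ≤ K * (1 + ‖G‖ + ‖U‖)

/-- continuous with at most exponential growth -/
def Nice (f : GM m n → UU r m n → ℝ) : Prop :=
  Continuous (fun ω : GM m n × UU r m n => f ω.1 ω.2) ∧
    ∃ K : ℝ, 0 ≤ K ∧ ∀ G U, |f G U| ≤ Real.exp (K * (1 + ‖G‖ + ‖U‖))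

/-- exponential of a function of linear growth -/
def PNice (f : GM m n → UU r m n → ℝ) : Prop :=
  ∃ L : GM m n → UU r m n → ℝ, LinGr L ∧ ∀ G U, f G U = Real.exp (L G U)

/-- integration over the `j`-th group -/
def II (j : Fin (r+1)) (f : GM m n → UU r m n → ℝ) : GM m n → UU r m n → ℝ :=
  fun G U => ∫ u, f G (Function.update U j u) ∂ muU m n

lemma norm_update_le (U : UU r m n) (j : Fin (r+1)) (u : Us m n) :
    ‖Function.update U j u‖ ≤ ‖U‖ + ‖u‖ := by
  refine (pi_norm_le_iff_of_nonneg (by positivity)).2 fun i => ?_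
  by_cases hi : i = j
  · subst hi; simp
  · rw [Function.update_of_ne hi]
    linarith [norm_le_pi_norm U i, norm_nonneg u]

lemma LinGr.add {f g : GM m n → UU r m n → ℝ} (hf : LinGr f) (hg : LinGr g) :
    LinGr (fun G U => f G U + g G U) := by
  obtain ⟨cf, K, hK, hf⟩ := hf
  obtain ⟨cg, K', hK', hg⟩ := hg
  refine ⟨cf.add cg, K + K', by positivity, fun G U => ?_⟩
  rw [add_mul]
  exact (abs_add_le _ _).trans (add_le_add (hf G U) (hg G U))

lemma LinGr.const_mul {f : GM m n → UU r m n → ℝ} (c : ℝ) (hf : LinGr f) :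
    LinGr (fun G U => c * f G U) := by
  obtain ⟨cf, K, hK, hf⟩ := hf
  refine ⟨continuous_const.mul cf, |c| * K, by positivity, fun G U => ?_⟩
  rw [abs_mul, mul_assoc]
  exact mul_le_mul_of_nonneg_left (hf G U) (abs_nonneg _)

lemma LinGr.mul_const {f : GM m n → UU r m n → ℝ} (c : ℝ) (hf : LinGr f) :
    LinGr (fun G U => f G U * c) := by
  simpa only [mul_comm] using hf.const_mul c

lemma LinGr.sum {ι : Type*} (s : Finset ι) {f : ι → GM m n → UU r m n → ℝ}
    (hf : ∀ i, LinGr (f i)) : LinGr (fun G U => ∑ i ∈ s, f i G U) := by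
  classical
  induction s using Finset.induction_on with
  | empty => exact ⟨by simpa using continuous_const, 0, le_rfl, by simp⟩
  | insert a s ha ih =>
    simp only [Finset.sum_insert ha]
    exact (hf a).add ih

lemma linGr_G (j : Fin m) (k : Fin n) : LinGr (fun (G : GM m n) (_ : UU r m n) => G j k) := by
  refine ⟨by fun_prop, 1, by norm_num, fun G U => ?_⟩
  have h1 : |G j k| ≤ ‖G‖ := (norm_le_pi_norm (G j) k).trans (norm_le_pi_norm G j)
  linarith [norm_nonneg U]

lemma linGr_u4 (k : Fin (r+1)) : LinGr (fun (_ : GM m n) (U : UU r m n) => (U k).1) := by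
  refine ⟨by fun_prop, 1, by norm_num, fun G U => ?_⟩
  have h1 : |(U k).1| ≤ ‖U‖ := (norm_fst_le (U k)).trans (norm_le_pi_norm U k)
  linarith [norm_nonneg G]

lemma linGr_u2 (k : Fin (r+1)) (j : Fin m) :
    LinGr (fun (_ : GM m n) (U : UU r m n) => (U k).2.1 j) := by
  refine ⟨by fun_prop, 1, by norm_num, fun G U => ?_⟩
  have h1 : |(U k).2.1 j| ≤ ‖U‖ := (norm_le_pi_norm (U k).2.1 j).trans
    ((norm_fst_le (U k).2).trans ((norm_snd_le (U k)).trans (norm_le_pi_norm U k)))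
  linarith [norm_nonneg G]

lemma linGr_h (k : Fin (r+1)) (j : Fin n) :
    LinGr (fun (_ : GM m n) (U : UU r m n) => (U k).2.2 j) := by
  refine ⟨by fun_prop, 1, by norm_num, fun G U => ?_⟩
  have h1 : |(U k).2.2 j| ≤ ‖U‖ := (norm_le_pi_norm (U k).2.2 j).trans
    ((norm_snd_le (U k).2).trans ((norm_snd_le (U k)).trans (norm_le_pi_norm U k)))
  linarith [norm_nonneg G]

lemma LinGr.nice {f : GM m n → UU r m n → ℝ} (hf : LinGr f) : Nice f := by
  obtain ⟨cf, K, hK, hf⟩ := hf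
  refine ⟨cf, K, hK, fun G U => (hf G U).trans ?_⟩
  linarith [Real.add_one_le_exp (K * (1 + ‖G‖ + ‖U‖))]

lemma PNice.nice {f : GM m n → UU r m n → ℝ} (hf : PNice f) : Nice f := by
  obtain ⟨L, ⟨cf, K, hK, hb⟩, hf⟩ := hf
  refine ⟨?_, K, hK, fun G U => ?_⟩
  · simp only [hf]; exact cf.rexp
  · rw [hf, abs_of_pos (Real.exp_pos _), Real.exp_le_exp]
    exact (le_abs_self _).trans (hb G U)

lemma PNice.pos {f : GM m n → UU r m n → ℝ} (hf : PNice f) (G U) : 0 < f G U := by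
  obtain ⟨L, _, hf⟩ := hf
  rw [hf]; exact Real.exp_pos _

lemma PNice.rpow {f : GM m n → UU r m n → ℝ} (hf : PNice f) (a : ℝ) :
    PNice (fun G U => f G U ^ a) := by
  obtain ⟨L, hL, hf⟩ := hf
  refine ⟨fun G U => L G U * a, hL.mul_const a, fun G U => ?_⟩
  simp only [hf, ← Real.exp_mul]

lemma PNice.mul {f g : GM m n → UU r m n → ℝ} (hf : PNice f) (hg : PNice g) :
    PNice (fun G U => f G U * g G U) := by
  obtain ⟨L, hL, hf⟩ := hf
  obtain ⟨L', hL', hg⟩ := hg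
  exact ⟨_, hL.add hL', fun G U => by simp only [hf, hg, Real.exp_add]⟩

lemma PNice.inv {f : GM m n → UU r m n → ℝ} (hf : PNice f) :
    PNice (fun G U => (f G U)⁻¹) := by
  obtain ⟨L, hL, hf⟩ := hf
  exact ⟨_, hL.const_mul (-1), fun G U => by simp only [hf, ← Real.exp_neg]; ring_nf⟩

/-- criterion for `PNice` -/
lemma pnice_of_bounds {f : GM m n → UU r m n → ℝ}
    (hc : Continuous (fun ω : GM m n × UU r m n => f ω.1 ω.2)) (K : ℝ) (hK : 0 ≤ K)
    (h1 : ∀ G U, Real.exp (-(K * (1 + ‖G‖ + ‖U‖))) ≤ f G U)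
    (h2 : ∀ G U, f G U ≤ Real.exp (K * (1 + ‖G‖ + ‖U‖))) : PNice f := by
  have hpos : ∀ G U, 0 < f G U := fun G U => (Real.exp_pos _).trans_le (h1 G U)
  refine ⟨fun G U => Real.log (f G U), ⟨hc.log fun ω => (hpos _ _).ne', K, hK, fun G U => ?_⟩,
    fun G U => (Real.exp_log (hpos G U)).symm⟩
  rw [abs_le]
  exact ⟨(Real.le_log_iff_exp_le (hpos G U)).2 (h1 G U),
    (Real.log_le_iff_le_exp (hpos G U)).2 (h2 G U)⟩

lemma two_mul_exp_le {K K' A : ℝ} (hA : 1 ≤ A) (hK : 0 ≤ K) (hK' : 0 ≤ K') :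
    Real.exp (K * A) + Real.exp (K' * A) ≤ Real.exp ((K + K' + 1) * A) := by
  have h1 : Real.exp (K * A) ≤ Real.exp ((K + K') * A) := Real.exp_le_exp.2 (by nlinarith)
  have h2 : Real.exp (K' * A) ≤ Real.exp ((K + K') * A) := Real.exp_le_exp.2 (by nlinarith)
  have h3 : (2 : ℝ) ≤ Real.exp A := by linarith [Real.add_one_le_exp A]
  have h4 : Real.exp ((K + K' + 1) * A) = Real.exp ((K + K') * A) * Real.exp A := by
    rw [← Real.exp_add]; ring_nf
  rw [h4]
  nlinarith [Real.exp_pos ((K + K') * A)]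

lemma Nice.add {f g : GM m n → UU r m n → ℝ} (hf : Nice f) (hg : Nice g) :
    Nice (fun G U => f G U + g G U) := by
  obtain ⟨cf, K, hK, hf⟩ := hf
  obtain ⟨cg, K', hK', hg⟩ := hg
  refine ⟨cf.add cg, K + K' + 1, by positivity, fun G U => ?_⟩
  refine (abs_add_le _ _).trans ((add_le_add (hf G U) (hg G U)).trans ?_)
  exact two_mul_exp_le (by linarith [norm_nonneg G, norm_nonneg U]) hK hK'

lemma Nice.mul {f g : GM m n → UU r m n → ℝ} (hf : Nice f) (hg : Nice g) :
    Nice (fun G U => f G U * g G U) := by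
  obtain ⟨cf, K, hK, hf⟩ := hf
  obtain ⟨cg, K', hK', hg⟩ := hg
  refine ⟨cf.mul cg, K + K', by positivity, fun G U => ?_⟩
  rw [add_mul, Real.exp_add, abs_mul]
  exact mul_le_mul (hf G U) (hg G U) (abs_nonneg _) (Real.exp_pos _).le

lemma nice_const (c : ℝ) : Nice (fun (_ : GM m n) (_ : UU r m n) => c) := by
  refine ⟨continuous_const, |c|, abs_nonneg _, fun G U => ?_⟩
  have : |c| * 1 ≤ |c| * (1 + ‖G‖ + ‖U‖) :=
    mul_le_mul_of_nonneg_left (by linarith [norm_nonneg G, norm_nonneg U]) (abs_nonneg _)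
  linarith [Real.add_one_le_exp (|c| * (1 + ‖G‖ + ‖U‖))]

lemma Nice.const_mul {f : GM m n → UU r m n → ℝ} (c : ℝ) (hf : Nice f) :
    Nice (fun G U => c * f G U) := (nice_const c).mul hf

lemma Nice.sum {ι : Type*} (s : Finset ι) {f : ι → GM m n → UU r m n → ℝ}
    (hf : ∀ i, Nice (f i)) : Nice (fun G U => ∑ i ∈ s, f i G U) := by
  classical
  induction s using Finset.induction_on with
  | empty => simpa using nice_const 0
  | insert a s ha ih =>
    simp only [Finset.sum_insert ha]
    exact (hf a).add ih

lemma PNice.add {f g : GM m n → UU r m n → ℝ} (hf : PNice f) (hg : PNice g) :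
    PNice (fun G U => f G U + g G U) := by
  have hn := hf.nice.add hg.nice
  have hg0 := hg.pos
  have hf0 := hf.pos
  obtain ⟨cf, K, hK, hb⟩ := hn
  obtain ⟨L, ⟨cL, K', hK', hL⟩, hf⟩ := hf
  refine pnice_of_bounds cf (K + K') (by positivity) (fun G U => ?_) (fun G U => ?_)
  · have : Real.exp (-((K + K') * (1 + ‖G‖ + ‖U‖))) ≤ f G U := by
      rw [hf, Real.exp_le_exp]
      have h0 : 0 ≤ K * (1 + ‖G‖ + ‖U‖) := by positivity
      linarith [neg_le_of_abs_le (hL G U)]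
    linarith [hg0 G U]
  · refine ((le_abs_self _).trans (hb G U)).trans (Real.exp_le_exp.2 ?_)
    have h0 : 0 ≤ K' * (1 + ‖G‖ + ‖U‖) := by positivity
    linarith

lemma PNice.sum {ι : Type*} (s : Finset ι) (hs : s.Nonempty) {f : ι → GM m n → UU r m n → ℝ}
    (hf : ∀ i, PNice (f i)) : PNice (fun G U => ∑ i ∈ s, f i G U) := by
  classical
  induction hs using Finset.Nonempty.cons_induction with
  | singleton a => simpa using hf a
  | cons a s ha _ ih =>
    simp only [Finset.sum_cons]
    exact (hf a).add ih

lemma exp_update_le {K : ℝ} (hK : 0 ≤ K) (G : GM m n) (U : UU r m n) (j : Fin (r+1)) (u : Us m n) :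
    Real.exp (K * (1 + ‖G‖ + ‖Function.update U j u‖)) ≤
      Real.exp (K * (1 + ‖G‖ + ‖U‖)) * Real.exp (K * ‖u‖) := by
  rw [← Real.exp_add, Real.exp_le_exp, ← mul_add]
  exact mul_le_mul_of_nonneg_left (by linarith [norm_update_le U j u]) hK

lemma Nice.cont_update {f : GM m n → UU r m n → ℝ} (hf : Nice f) (j : Fin (r+1)) (G U) :
    Continuous (fun u => f G (Function.update U j u)) :=
  hf.1.comp (continuous_const.prodMk (continuous_const.update j continuous_id))

lemma Nice.integrable {f : GM m n → UU r m n → ℝ} (hf : Nice f) (j : Fin (r+1)) (G U) :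
    Integrable (fun u => f G (Function.update U j u)) (muU m n) := by
  obtain ⟨K, hK, hb⟩ := hf.2
  refine ((expInt_muU m n K hK).const_mul (Real.exp (K * (1 + ‖G‖ + ‖U‖)))).mono'
    (hf.cont_update j G U).aestronglyMeasurable (ae_of_all _ fun u => ?_)
  exact (hb _ _).trans (exp_update_le hK G U j u)

lemma Nice.integrable_all {f : GM m n → UU r m n → ℝ} (hf : Nice f) :
    Integrable (fun ω : GM m n × UU r m n => f ω.1 ω.2) (muAll r m n) := by
  obtain ⟨cf, K, hK, hb⟩ := hf
  have := ((expInt_gMat m n K hK).mul_prod (expInt_muUs r m n K hK)).const_mul (Real.exp K)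
  refine this.mono' cf.aestronglyMeasurable (ae_of_all _ fun ω => (hb _ _).trans (le_of_eq ?_))
  rw [← Real.exp_add, ← Real.exp_add]
  ring_nf

lemma integral_expn_pos (K : ℝ) (hK : 0 ≤ K) : 0 < ∫ u, Real.exp (K * ‖u‖) ∂ muU m n :=
  integral_exp_pos (expInt_muU m n K hK)

lemma integrable_exp_neg (K : ℝ) (hK : 0 ≤ K) :
    Integrable (fun u => Real.exp (-(K * ‖u‖))) (muU m n) := by
  refine (integrable_const (1:ℝ)).mono' (by fun_prop) (ae_of_all _ fun u => ?_)
  rw [Real.norm_eq_abs, abs_of_pos (Real.exp_pos _)]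
  exact Real.exp_le_one_iff.2 (by have := norm_nonneg u; nlinarith)

lemma Nice.II {f : GM m n → UU r m n → ℝ} (hf : Nice f) (j : Fin (r+1)) : Nice (II j f) := by
  have hi := hf.integrable j
  have hcu := hf.cont_update j
  obtain ⟨cf, K, hK, hb⟩ := hf
  set M := ∫ u, Real.exp (K * ‖u‖) ∂ muU m n with hM
  have hMp : 0 < M := integral_expn_pos K hK
  refine ⟨?_, K + M, by positivity, fun G U => ?_⟩
  · rw [continuous_iff_continuousAt]
    intro ω₀
    refine continuousAt_of_dominated (bound := fun u =>
      Real.exp (K * (1 + (‖ω₀.1‖ + 1) + (‖ω₀.2‖ + 1))) * Real.exp (K * ‖u‖))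
      (Eventually.of_forall fun ω => (hcu ω.1 ω.2).aestronglyMeasurable) ?_
      ((expInt_muU m n K hK).const_mul _) (ae_of_all _ fun u => ?_)
    · have e1 : ∀ᶠ ω in 𝓝 ω₀, ‖ω.1‖ < ‖ω₀.1‖ + 1 :=
        (continuous_fst.norm.continuousAt (x := ω₀)).eventually_lt continuousAt_const (by simp)
      have e2 : ∀ᶠ ω in 𝓝 ω₀, ‖ω.2‖ < ‖ω₀.2‖ + 1 :=
        (continuous_snd.norm.continuousAt (x := ω₀)).eventually_lt continuousAt_const (by simp)
      filter_upwards [e1, e2] with ω h1 h2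
      refine ae_of_all _ fun u => ((hb _ _).trans (exp_update_le hK _ _ j u)).trans ?_
      refine mul_le_mul_of_nonneg_right (Real.exp_le_exp.2 ?_) (Real.exp_pos _).le
      exact mul_le_mul_of_nonneg_left (by linarith) hK
    · exact (cf.comp (continuous_fst.prodMk
        (continuous_snd.update j continuous_const))).continuousAt
  · have h1 : |SFLR.II j f G U| ≤ Real.exp (K * (1 + ‖G‖ + ‖U‖)) * M := by
      rw [hM, ← integral_const_mul]
      refine norm_integral_le_of_norm_le (f := fun u => f G (Function.update U j u)) ((expInt_muU m n K hK).const_mul _)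
        (ae_of_all _ fun u => ?_)
      exact (hb _ _).trans (exp_update_le hK G U j u)
    refine h1.trans ?_
    rw [add_mul, Real.exp_add]
    refine mul_le_mul_of_nonneg_left ?_ (Real.exp_pos _).le
    have : M * 1 ≤ M * (1 + ‖G‖ + ‖U‖) :=
      mul_le_mul_of_nonneg_left (by linarith [norm_nonneg G, norm_nonneg U]) hMp.le
    linarith [Real.add_one_le_exp (M * (1 + ‖G‖ + ‖U‖))]

lemma PNice.II {f : GM m n → UU r m n → ℝ} (hf : PNice f) (j : Fin (r+1)) : PNice (II j f) := by
  have hn := hf.nice.II j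
  have hi := hf.nice.integrable j
  obtain ⟨L, ⟨cL, K', hK', hL⟩, hf⟩ := hf
  obtain ⟨cf, K, hK, hb⟩ := hn
  set M := ∫ u, Real.exp (-(K' * ‖u‖)) ∂ muU m n with hM
  have hMp : 0 < M := integral_exp_pos (integrable_exp_neg K' hK')
  refine pnice_of_bounds cf (K + K' + |Real.log M|) (by positivity) (fun G U => ?_)
    (fun G U => ?_)
  · have h1 : Real.exp (-(K' * (1 + ‖G‖ + ‖U‖))) * M ≤ SFLR.II j f G U := by
      rw [hM, ← integral_const_mul]
      refine integral_mono ((integrable_exp_neg K' hK').const_mul _) (hi G U) fun u => ?_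
      simp only
      rw [hf, ← Real.exp_add, Real.exp_le_exp]
      have h2 := neg_le_of_abs_le (hL G (Function.update U j u))
      have h3 := mul_le_mul_of_nonneg_left (norm_update_le U j u) hK'
      linarith
    refine le_trans ?_ h1
    have h0 : 0 ≤ K * (1 + ‖G‖ + ‖U‖) := by positivity
    have h4 : |Real.log M| * 1 ≤ |Real.log M| * (1 + ‖G‖ + ‖U‖) :=
      mul_le_mul_of_nonneg_left (by linarith [norm_nonneg G, norm_nonneg U]) (abs_nonneg _)
    have h5 := neg_abs_le (Real.log M)
    calc _ ≤ Real.exp (-(K' * (1 + ‖G‖ + ‖U‖)) + Real.log M) := Real.exp_le_exp.2 (by linarith)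
      _ = _ := by rw [Real.exp_add, Real.exp_log hMp]
  · refine ((le_abs_self _).trans (hb G U)).trans (Real.exp_le_exp.2 ?_)
    exact mul_le_mul_of_nonneg_right (by linarith [abs_nonneg (Real.log M)]) (by positivity)

lemma II_congr (j : Fin (r+1)) {f g : GM m n → UU r m n → ℝ} (h : ∀ G U, f G U = g G U) :
    II j f = II j g := by
  have : f = g := by ext G U; exact h G U
  rw [this]

lemma II_add (j : Fin (r+1)) {f g : GM m n → UU r m n → ℝ} (hf : Nice f) (hg : Nice g) (G U) :
    II j (fun G U => f G U + g G U) G U = II j f G U + II j g G U :=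
  integral_add (hf.integrable j G U) (hg.integrable j G U)

lemma II_sub (j : Fin (r+1)) {f g : GM m n → UU r m n → ℝ} (hf : Nice f) (hg : Nice g) (G U) :
    II j (fun G U => f G U - g G U) G U = II j f G U - II j g G U :=
  integral_sub (hf.integrable j G U) (hg.integrable j G U)

lemma II_const_mul (j : Fin (r+1)) (c : ℝ) (f : GM m n → UU r m n → ℝ) (G U) :
    II j (fun G U => c * f G U) G U = c * II j f G U :=
  integral_const_mul _ _

lemma II_sum {ι : Type*} (s : Finset ι) (j : Fin (r+1)) {f : ι → GM m n → UU r m n → ℝ}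
    (hf : ∀ i, Nice (f i)) (G U) :
    II j (fun G U => ∑ i ∈ s, f i G U) G U = ∑ i ∈ s, II j (f i) G U :=
  integral_finsetSum _ (fun i _ => (hf i).integrable j G U)

/-- resampling one group does not change the total expectation -/
lemma integral_II (j : Fin (r+1)) {f : GM m n → UU r m n → ℝ} (hf : Nice f) :
    ∫ ω, II j f ω.1 ω.2 ∂ muAll r m n = ∫ ω, f ω.1 ω.2 ∂ muAll r m n := by
  have h1 := (hf.II j).integrable_all
  have h2 := hf.integrable_all
  unfold muAll at h1 h2 ⊢
  rw [integral_prod _ h1, integral_prod _ h2]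
  have h3 := h2.prod_right_ae
  refine integral_congr_ae ?_
  filter_upwards [h3] with G hG
  have mp := map_update_pi (ι := Fin (r+1)) (muU m n) j
  have hG' : Integrable (fun z : UU r m n × Us m n => f G (Function.update z.1 j z.2))
      ((Measure.pi fun _ : Fin (r+1) => muU m n).prod (muU m n)) :=
    mp.integrable_comp_of_integrable hG
  have h4 := integral_prod _ hG'
  simp only [II]
  rw [← h4]
  have h5 := integral_map (f := f G) mp.measurable.aemeasurable
    (by rw [mp.map_eq]; exact hG.aestronglyMeasurable)
  rw [mp.map_eq] at h5
  exact h5.symm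

/-- `f` has, with respect to the scalar in each group with index at least `k`, the derivative
`a κ * f'`; both functions are of exponential growth. -/
structure DD (a : ℕ → ℝ) (k : ℕ) (f f' : GM m n → UU r m n → ℝ) : Prop where
  nf : Nice f
  nf' : Nice f'
  der : ∀ κ : Fin (r+1), k ≤ (κ : ℕ) → ∀ (G : GM m n) (U : UU r m n)
    (w : (Fin m → ℝ) × (Fin n → ℝ)) (τ : ℝ),
    HasDerivAt (fun τ : ℝ => f G (Function.update U κ ((τ, w) : Us m n)))
      (a κ * f' G (Function.update U κ ((τ, w) : Us m n))) τ

variable {a : ℕ → ℝ} {k : ℕ}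

lemma DD.congr {f f' g g' : GM m n → UU r m n → ℝ} (h : DD a k f f')
    (h1 : ∀ G U, g G U = f G U) (h2 : ∀ G U, g' G U = f' G U) : DD a k g g' := by
  have e1 : g = f := by ext G U; exact h1 G U
  have e2 : g' = f' := by ext G U; exact h2 G U
  rw [e1, e2]; exact h

lemma DD.mono {f f' : GM m n → UU r m n → ℝ} (h : DD a k f f') {k' : ℕ} (hk : k ≤ k') :
    DD a k' f f' := ⟨h.nf, h.nf', fun κ hκ => h.der κ (hk.trans hκ)⟩

lemma DD.mul {f f' g g' : GM m n → UU r m n → ℝ} (hf : DD a k f f') (hg : DD a k g g') :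
    DD a k (fun G U => f G U * g G U) (fun G U => f' G U * g G U + f G U * g' G U) := by
  refine ⟨hf.nf.mul hg.nf, (hf.nf'.mul hg.nf).add (hf.nf.mul hg.nf'), fun κ hκ G U w τ => ?_⟩
  exact ((hf.der κ hκ G U w τ).mul (hg.der κ hκ G U w τ)).congr_deriv (by ring)

lemma DD.const_mul {f f' : GM m n → UU r m n → ℝ} (c : ℝ) (hf : DD a k f f') :
    DD a k (fun G U => c * f G U) (fun G U => c * f' G U) := by
  refine ⟨hf.nf.const_mul c, hf.nf'.const_mul c, fun κ hκ G U w τ => ?_⟩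
  exact ((hf.der κ hκ G U w τ).const_mul c).congr_deriv (by ring)

lemma DD.sum {ι : Type*} (s : Finset ι) {f f' : ι → GM m n → UU r m n → ℝ}
    (hf : ∀ i, DD a k (f i) (f' i)) :
    DD a k (fun G U => ∑ i ∈ s, f i G U) (fun G U => ∑ i ∈ s, f' i G U) := by
  refine ⟨Nice.sum s fun i => (hf i).nf, Nice.sum s fun i => (hf i).nf', fun κ hκ G U w τ => ?_⟩
  rw [Finset.mul_sum]
  exact HasDerivAt.fun_sum fun i _ => (hf i).der κ hκ G U w τ

lemma DD.rpow {f f' : GM m n → UU r m n → ℝ} (hp : PNice f) (hf : DD a k f f') (c : ℝ) :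
    DD a k (fun G U => f G U ^ c) (fun G U => c * (f G U ^ (c - 1) * f' G U)) := by
  refine ⟨(hp.rpow c).nice, ((hp.rpow (c-1)).nice.mul hf.nf').const_mul c, fun κ hκ G U w τ => ?_⟩
  exact ((hf.der κ hκ G U w τ).rpow_const (Or.inl (hp.pos _ _).ne')).congr_deriv (by ring)

lemma DD.II {f f' : GM m n → UU r m n → ℝ} (j : Fin (r+1)) (hf : DD a (j : ℕ) f f') :
    DD a ((j : ℕ) + 1) (II j f) (II j f') := by
  refine ⟨hf.nf.II j, hf.nf'.II j, fun κ hκ G U w τ₀ => ?_⟩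
  have hne : κ ≠ j := by rintro rfl; omega
  obtain ⟨K, hK, hb⟩ := hf.nf'.2
  simp only [SFLR.II]
  rw [← integral_const_mul]
  set B : ℝ := 1 + ‖G‖ + (‖U‖ + (|τ₀| + 1 + ‖w‖)) with hB
  refine (hasDerivAt_integral_of_dominated_loc_of_deriv_le (𝕜 := ℝ)
    (s := Metric.ball τ₀ 1) (x₀ := τ₀)
    (F := fun τ u => f G (Function.update (Function.update U κ ((τ, w) : Us m n)) j u))
    (F' := fun τ u => a κ * f' G (Function.update (Function.update U κ ((τ, w) : Us m n)) j u))
    (bound := fun u => |a κ| * (Real.exp (K * B) * Real.exp (K * ‖u‖)))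
    (Metric.ball_mem_nhds _ one_pos)
    (Eventually.of_forall fun τ => (hf.nf.cont_update j G _).aestronglyMeasurable)
    (hf.nf.integrable j G _)
    ((hf.nf'.cont_update j G _).aestronglyMeasurable.const_mul _) ?_
    (((expInt_muU m n K hK).const_mul _).const_mul _) ?_).2
  · refine ae_of_all _ fun u τ hτ => ?_
    rw [norm_mul]
    refine mul_le_mul_of_nonneg_left ?_ (norm_nonneg _)
    refine ((hb _ _).trans (exp_update_le hK _ _ j u)).trans ?_
    refine mul_le_mul_of_nonneg_right (Real.exp_le_exp.2 ?_) (Real.exp_pos _).le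
    refine mul_le_mul_of_nonneg_left ?_ hK
    have h1 := norm_update_le U κ ((τ, w) : Us m n)
    have h2 : ‖((τ, w) : Us m n)‖ ≤ |τ| + ‖w‖ := by
      rw [Prod.norm_def]
      exact max_le (by simp) (by simp)
    have h3 : |τ| ≤ |τ₀| + 1 := by
      have h4 : |τ - τ₀| < 1 := by simpa [Real.dist_eq] using hτ
      have h5 := abs_sub_abs_le_abs_sub τ τ₀
      linarith
    rw [hB]; linarith
  · refine ae_of_all _ fun u τ _ => ?_
    simp only [Function.update_comm hne]
    exact hf.der κ (by omega) G _ w τ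

/-- Gaussian integration by parts in one of the groups -/
lemma DD.stein {f f' : GM m n → UU r m n → ℝ} (hf : DD a k f f') (κ : Fin (r+1))
    (hκ : k ≤ (κ : ℕ)) (G : GM m n) (U : UU r m n) :
    SFLR.II κ (fun G U => f G U * (U κ).1) G U = a κ * SFLR.II κ f' G U := by
  have h0 := hf.nf.integrable κ G U
  have h1 := (hf.nf.mul (linGr_u4 κ).nice).integrable κ G U
  have h2 := (hf.nf'.const_mul (a κ)).integrable κ G U
  simp only [SFLR.II]
  rw [← integral_const_mul]
  simp only [Function.update_self] at h1 ⊢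
  unfold muU at h0 h1 h2 ⊢
  rw [integral_prod_symm _ h1, integral_prod_symm _ h2]
  refine integral_congr_ae ?_
  filter_upwards [h0.prod_left_ae, h1.prod_left_ae, h2.prod_left_ae] with w k0 k1 k2
  rw [← stein_one (fun τ => hf.der κ hκ G U w τ) k0 (by simpa only [mul_comm] using k1) k2]
  simp only [mul_comm]

/-- the coefficients `a_k` -/
def acoef (p q : ℕ → ℝ) (k : ℕ) : ℝ := Real.sqrt (p k * q k - p (k+1) * q (k+1))

section concrete

variable (r) (β s t : ℝ) (mv p q : ℕ → ℝ) (x : Fin l → Fin n → ℝ) (y : Fin l → Fin m → ℝ)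

/-- the function `(C^{(i₁)})^{s-1} A^{(i₁,i₂)}` -/
def gF (i : Fin l × Fin l) (G : GM m n) (U : UU r m n) : ℝ :=
  CR r 1 β s t mv p q x y G U i.1 ^ (s - 1) * AR r 1 β s t mv p q x y G U i.1 i.2

/-- the product of the norms -/
def dF (x : Fin l → Fin n → ℝ) (y : Fin l → Fin m → ℝ) (i : Fin l × Fin l) : ℝ :=
  nrm2 (x i.1) * nrm2 (y i.2)

local notation "ζF" => fun j G U => zetaR r 1 β s t mv p q x y G j U
local notation "νF" => nestR r 1 β s t mv p q x y

lemma zeta_succ {j : ℕ} (h : j < r + 1) (G : GM m n) (U : UU r m n) :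
    zetaR r 1 β s t mv p q x y G (j+1) U =
      II ⟨j, h⟩ (fun G U => zetaR r 1 β s t mv p q x y G j U ^ (mv (j+1) / mv j)) G U := by
  rw [zetaR, dif_pos h]; rfl

lemma nest_succ (g : GM m n → UU r m n → ℝ) {j : ℕ} (h : j < r + 1) (G : GM m n) (U : UU r m n) :
    νF g (j+1) G U =
      II ⟨j, h⟩ (fun G U => zetaR r 1 β s t mv p q x y G j U ^ (mv (j+1) / mv j - 1)
        * νF g j G U) G U := by
  simp only [nestR, dif_pos h]; rfl

lemma linGr_D (i1 i2 : Fin l) :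
    LinGr (fun (G : GM m n) (U : UU r m n) => D0R r 1 β s t mv p q x y G U i1 i2) := by
  unfold D0R
  refine ((LinGr.add ?_ ?_).add ?_).add ?_
  · exact (LinGr.sum _ fun j => LinGr.sum _ fun k => ((linGr_G j k).mul_const _).const_mul _).const_mul _
  · exact (LinGr.sum _ fun j => (LinGr.sum _ fun k => (linGr_u2 k j).const_mul _).const_mul _).const_mul _
  · exact ((LinGr.sum _ fun k => (linGr_u4 k).const_mul _).const_mul _).const_mul _
  · exact (LinGr.sum _ fun j => (LinGr.sum _ fun k => (linGr_h k j).const_mul _).mul_const _).const_mul _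

lemma pnice_A (i1 i2 : Fin l) :
    PNice (fun (G : GM m n) (U : UU r m n) => AR r 1 β s t mv p q x y G U i1 i2) :=
  ⟨_, (linGr_D r β s t mv p q x y i1 i2).const_mul β, fun G U => rfl⟩

lemma pnice_C (hl : 1 ≤ l) (i1 : Fin l) :
    PNice (fun (G : GM m n) (U : UU r m n) => CR r 1 β s t mv p q x y G U i1) :=
  PNice.sum _ ⟨i1, Finset.mem_univ _⟩ fun i2 => pnice_A r β s t mv p q x y i1 i2

lemma pnice_Z (hl : 1 ≤ l) :
    PNice (fun (G : GM m n) (U : UU r m n) => ZR r 1 β s t mv p q x y G U) :=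
  PNice.sum _ ⟨⟨0, hl⟩, Finset.mem_univ _⟩ fun i1 => (pnice_C r β s t mv p q x y hl i1).rpow s

lemma pnice_zeta (hl : 1 ≤ l) (j : ℕ) (hj : j ≤ r + 1) :
    PNice (fun (G : GM m n) (U : UU r m n) => zetaR r 1 β s t mv p q x y G j U) := by
  induction j with
  | zero => exact pnice_Z r β s t mv p q x y hl
  | succ j ih =>
    have := ((ih (by omega)).rpow (mv (j+1) / mv j)).II ⟨j, by omega⟩
    simpa only [zeta_succ r β s t mv p q x y (show j < r + 1 by omega)] using this

lemma nice_nest (hl : 1 ≤ l) {g : GM m n → UU r m n → ℝ} (hg : Nice g) (j : ℕ) (hj : j ≤ r + 1) :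
    Nice (fun (G : GM m n) (U : UU r m n) => νF g j G U) := by
  induction j with
  | zero => exact hg
  | succ j ih =>
    have := (((pnice_zeta r β s t mv p q x y hl j (by omega)).rpow
      (mv (j+1) / mv j - 1)).nice.mul (ih (by omega))).II ⟨j, by omega⟩
    simpa only [nest_succ r β s t mv p q x y g (show j < r + 1 by omega)] using this

lemma D0R_der (i : Fin l × Fin l) (κ : Fin (r+1)) (G : GM m n) (U : UU r m n)
    (w : (Fin m → ℝ) × (Fin n → ℝ)) (τ : ℝ) :
    HasDerivAt (fun τ : ℝ => D0R r 1 β s t mv p q x y G (Function.update U κ ((τ, w) : Us m n)) i.1 i.2)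
      (acoef p q κ * (√t * dF x y i)) τ := by
  have e2 : ∀ (τ : ℝ) (k : Fin (r+1)), (Function.update U κ ((τ, w) : Us m n) k).2 =
      (Function.update U κ ((0, w) : Us m n) k).2 := by
    intro τ k
    by_cases hk : k = κ
    · subst hk; simp
    · simp [Function.update_of_ne hk]
  have e1 : ∀ (k : Fin (r+1)), HasDerivAt
      (fun τ : ℝ => acoef p q k * (Function.update U κ ((τ, w) : Us m n) k).1)
      (if k = κ then acoef p q k else 0) τ := by
    intro k
    by_cases hk : k = κ
    · subst hk; simpa using (hasDerivAt_id τ).const_mul (acoef p q k)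
    · simp only [Function.update_of_ne hk, if_neg hk]
      exact hasDerivAt_const _ _
  have e3 := HasDerivAt.fun_sum (u := Finset.univ) fun k _ => e1 k
  rw [Finset.sum_ite_eq' Finset.univ κ (fun k => acoef p q k), if_pos (Finset.mem_univ _)] at e3
  unfold D0R
  simp only [e2]
  have e4 := ((((e3.const_mul (√t * nrm2 (x i.1) * nrm2 (y i.2))).const_mul 1).const_add
    (√t * (∑ j, ∑ k, y i.2 j * (G j k * x i.1 k))
    + √(1 - t) * nrm2 (x i.1) *
        (∑ j, y i.2 j * (∑ k : Fin (r+1), √(p (k : ℕ) - p ((k : ℕ) + 1)) *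
          (Function.update U κ ((0, w) : Us m n) k).2.1 j)))).add_const
    (√(1 - t) * nrm2 (y i.2) *
        (∑ kk, (∑ k : Fin (r+1), √(q (k : ℕ) - q ((k : ℕ) + 1)) *
          (Function.update U κ ((0, w) : Us m n) k).2.2 kk) * x i.1 kk)))
  exact e4.congr_deriv (by unfold dF; ring)

lemma DD_A (i : Fin l × Fin l) :
    DD (acoef p q) 0 (fun (G : GM m n) (U : UU r m n) => AR r 1 β s t mv p q x y G U i.1 i.2)
      (fun G U => β * √t * (dF x y i * AR r 1 β s t mv p q x y G U i.1 i.2)) := by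
  refine ⟨(pnice_A r β s t mv p q x y i.1 i.2).nice,
    ((pnice_A r β s t mv p q x y i.1 i.2).nice.const_mul _).const_mul _, fun κ _ G U w τ => ?_⟩
  unfold AR
  exact ((D0R_der r β s t mv p q x y i κ G U w τ).const_mul β).exp.congr_deriv (by ring)

lemma DD_C (i1 : Fin l) :
    DD (acoef p q) 0 (fun (G : GM m n) (U : UU r m n) => CR r 1 β s t mv p q x y G U i1)
      (fun G U => ∑ i2, β * √t * (dF x y (i1, i2) * AR r 1 β s t mv p q x y G U i1 i2)) :=
  DD.sum _ fun i2 => DD_A r β s t mv p q x y (i1, i2)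

lemma DD_Z (hl : 1 ≤ l) :
    DD (acoef p q) 0 (fun (G : GM m n) (U : UU r m n) => ZR r 1 β s t mv p q x y G U)
      (fun G U => β * √t * s * ∑ i, dF x y i * gF r β s t mv p q x y i G U) := by
  have := DD.sum Finset.univ fun i1 =>
    (DD_C r β s t mv p q x y i1).rpow (pnice_C r β s t mv p q x y hl i1) s
  refine this.congr (fun G U => rfl) fun G U => ?_
  rw [Fintype.sum_prod_type, Finset.mul_sum]
  refine Finset.sum_congr rfl fun i1 _ => ?_
  rw [Finset.mul_sum, Finset.mul_sum, Finset.mul_sum]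
  refine Finset.sum_congr rfl fun i2 _ => ?_
  simp only [gF]; ring

lemma DD_g (hl : 1 ≤ l) (i : Fin l × Fin l) :
    ∃ g', DD (acoef p q) 0 (gF r β s t mv p q x y i) g' :=
  ⟨_, ((DD_C r β s t mv p q x y i.1).rpow (pnice_C r β s t mv p q x y hl i.1) (s-1)).mul
    (DD_A r β s t mv p q x y i)⟩

lemma DD_zeta (hl : 1 ≤ l) (hm0 : mv 0 = 1) (hmpos : ∀ k, 1 ≤ k → k ≤ r → 0 < mv k)
    (j : ℕ) (hj : j ≤ r) :
    DD (acoef p q) j (fun (G : GM m n) (U : UU r m n) => zetaR r 1 β s t mv p q x y G j U)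
      (fun G U => β * √t * s * mv j * ∑ i, dF x y i * νF (gF r β s t mv p q x y i) j G U) := by
  have ng : ∀ i, Nice (gF r β s t mv p q x y i) := fun i =>
    (DD_g r β s t mv p q x y hl i).choose_spec.nf
  induction j with
  | zero =>
    rw [hm0]
    exact (DD_Z r β s t mv p q x y hl).congr (fun G U => rfl) (fun G U => by simp only [mul_one]; rfl)
  | succ j ih =>
    have hmj : mv j ≠ 0 := by
      rcases Nat.eq_zero_or_pos j with h | h
      · rw [h, hm0]; exact one_ne_zero
      · exact (hmpos j h (by omega)).ne'
    have hj' : j < r + 1 := by omega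
    have pz := pnice_zeta r β s t mv p q x y hl j (by omega)
    have := DD.II ⟨j, hj'⟩ ((ih (by omega)).rpow pz (mv (j+1) / mv j))
    refine this.congr (fun G U => zeta_succ r β s t mv p q x y hj' G U) fun G U => ?_
    simp only [nest_succ r β s t mv p q x y _ hj']
    have nn : ∀ i, Nice (fun G U => zetaR r 1 β s t mv p q x y G j U ^ (mv (j+1) / mv j - 1)
        * νF (gF r β s t mv p q x y i) j G U) := fun i =>
      (pz.rpow _).nice.mul (nice_nest r β s t mv p q x y hl (ng i) j (by omega))
    simp only [← II_const_mul]
    rw [← II_sum _ _ (fun i => (nn i).const_mul (dF x y i)), ← II_const_mul]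
    refine congrFun (congrFun (II_congr _ fun G U => ?_) G) U
    rw [Finset.mul_sum, Finset.mul_sum, Finset.mul_sum, Finset.mul_sum]
    refine Finset.sum_congr rfl fun i _ => ?_
    field_simp

lemma DD_nest (hl : 1 ≤ l) (hm0 : mv 0 = 1) (hmpos : ∀ k, 1 ≤ k → k ≤ r → 0 < mv k)
    (i : Fin l × Fin l) (j : ℕ) (hj : j ≤ r) :
    ∃ g', DD (acoef p q) j (fun (G : GM m n) (U : UU r m n) =>
      νF (gF r β s t mv p q x y i) j G U) g' := by
  induction j with
  | zero => exact DD_g r β s t mv p q x y hl i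
  | succ j ih =>
    obtain ⟨g', hg'⟩ := ih (by omega)
    have hj' : j < r + 1 := by omega
    have pz := pnice_zeta r β s t mv p q x y hl j (by omega)
    exact ⟨_, (DD.II ⟨j, hj'⟩ (((DD_zeta r β s t mv p q x y hl hm0 hmpos j (by omega)).rpow pz
      (mv (j+1) / mv j - 1)).mul hg')).congr
      (fun G U => nest_succ r β s t mv p q x y _ hj' G U) fun G U => rfl⟩

lemma nest_u4 (g : GM m n → UU r m n → ℝ) (c : ℕ) (hc : c < r + 1) (j : ℕ) (hj : j ≤ c)
    (G : GM m n) (U : UU r m n) :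
    νF (fun G U => g G U * u4c U (c+1)) j G U = νF g j G U * (U ⟨c, hc⟩).1 := by
  induction j generalizing U with
  | zero => simp [nestR, u4c, hc]
  | succ j ih =>
    have hj' : j < r + 1 := by omega
    have hne : (⟨c, hc⟩ : Fin (r+1)) ≠ ⟨j, hj'⟩ := by
      intro h; rw [Fin.mk.injEq] at h; omega
    rw [nest_succ r β s t mv p q x y _ hj', nest_succ r β s t mv p q x y _ hj']
    simp only [II]
    rw [← integral_mul_const]
    refine integral_congr_ae (ae_of_all _ fun u => ?_)
    simp only
    rw [ih (by omega), Function.update_of_ne hne, mul_assoc]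

lemma Phi_nest (hl : 1 ≤ l) (i1 i2 : Fin l) (j : ℕ) (hj : j ≤ r) (G : GM m n) (U : UU r m n) :
    PhiUpToR r 1 β s t mv p q x y 1 j (gam0R r 1 β s t mv p q x y i1 i2) G U =
      νF (gF r β s t mv p q x y (i1, i2)) j G U / zetaR r 1 β s t mv p q x y G j U := by
  induction j generalizing U with
  | zero =>
    have hC := (pnice_C r β s t mv p q x y hl i1).pos G U
    simp only [PhiUpToR, gam0R, nestR, gF, zetaR]
    rw [Real.rpow_sub_one hC.ne']
    ring
  | succ j ih =>
    have hj' : j < r + 1 := by omega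
    rw [PhiUpToR, if_neg (by omega), nest_succ r β s t mv p q x y _ hj']
    simp only [PhiR, Nat.add_sub_cancel, dif_pos hj', II]
    congr 1
    refine integral_congr_ae (ae_of_all _ fun u => ?_)
    simp only
    rw [ih (by omega), Real.rpow_sub_one ((pnice_zeta r β s t mv p q x y hl j (by omega)).pos _ _).ne']
    ring

/-- the unnormalised version of `γ_{k+1}` at level `j` -/
def BF (k j : ℕ) (i i' : Fin l × Fin l) (G : GM m n) (U : UU r m n) : ℝ :=
  zetaR r 1 β s t mv p q x y G j U * PhiUpToR r 1 β s t mv p q x y (k+1) j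
    (fun G U =>
      PhiUpToR r 1 β s t mv p q x y 1 k (gam0R r 1 β s t mv p q x y i.1 i.2) G U *
        PhiUpToR r 1 β s t mv p q x y 1 k (gam0R r 1 β s t mv p q x y i'.1 i'.2) G U) G U

lemma BF_base (hl : 1 ≤ l) (k : ℕ) (hk1 : 1 ≤ k) (hk : k ≤ r) (i i' : Fin l × Fin l)
    (G : GM m n) (U : UU r m n) :
    BF r β s t mv p q x y k k i i' G U = (zetaR r 1 β s t mv p q x y G k U)⁻¹ *
      (νF (gF r β s t mv p q x y i) k G U * νF (gF r β s t mv p q x y i') k G U) := by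
  have hz := ((pnice_zeta r β s t mv p q x y hl k (by omega)).pos G U).ne'
  obtain ⟨k, rfl⟩ : ∃ k', k = k' + 1 := ⟨k - 1, by omega⟩
  unfold BF
  rw [PhiUpToR, if_pos (by omega), Phi_nest r β s t mv p q x y hl _ _ _ hk,
    Phi_nest r β s t mv p q x y hl _ _ _ hk]
  field_simp

lemma BF_succ (hl : 1 ≤ l) (k j : ℕ) (hkj : k ≤ j) (hj : j < r + 1) (i i' : Fin l × Fin l)
    (G : GM m n) (U : UU r m n) :
    BF r β s t mv p q x y k (j+1) i i' G U =
      II ⟨j, hj⟩ (fun G U => zetaR r 1 β s t mv p q x y G j U ^ (mv (j+1) / mv j - 1) *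
        BF r β s t mv p q x y k j i i' G U) G U := by
  have hz := ((pnice_zeta r β s t mv p q x y hl (j+1) (by omega)).pos G U).ne'
  conv_lhs => unfold BF
  rw [PhiUpToR, if_neg (by omega)]
  simp only [PhiR, Nat.add_sub_cancel, dif_pos hj, II]
  rw [mul_div_cancel₀ _ hz]
  refine integral_congr_ae (ae_of_all _ fun u => ?_)
  simp only
  have hz' := ((pnice_zeta r β s t mv p q x y hl j (by omega)).pos G
    (Function.update U ⟨j, hj⟩ u)).ne'
  rw [Real.rpow_sub_one hz', BF]
  field_simp

lemma nice_g (hl : 1 ≤ l) (i : Fin l × Fin l) : Nice (gF r β s t mv p q x y i) :=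
  (DD_g r β s t mv p q x y hl i).choose_spec.nf

lemma nice_gu (hl : 1 ≤ l) (i : Fin l × Fin l) (c : ℕ) (hc : c < r + 1) :
    Nice (fun G U => gF r β s t mv p q x y i G U * u4c U (c+1)) := by
  have := (nice_g r β s t mv p q x y hl i).mul (linGr_u4 ⟨c, hc⟩).nice
  simpa [u4c, hc] using this

lemma Nice.congr {f g : GM m n → UU r m n → ℝ} (h : Nice f) (e : ∀ G U, g G U = f G U) :
    Nice g := by
  have : g = f := by funext G U; exact e G U
  rw [this]; exact h

lemma nice_BF (hl : 1 ≤ l) (k : ℕ) (hk1 : 1 ≤ k) (hk : k ≤ r) (i i' : Fin l × Fin l) (j : ℕ)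
    (hkj : k ≤ j) (hj : j ≤ r + 1) : Nice (BF r β s t mv p q x y k j i i') := by
  induction j, hkj using Nat.le_induction with
  | base =>
    have := (pnice_zeta r β s t mv p q x y hl k (by omega)).inv.nice.mul
      ((nice_nest r β s t mv p q x y hl (nice_g r β s t mv p q x y hl i) k (by omega)).mul
      (nice_nest r β s t mv p q x y hl (nice_g r β s t mv p q x y hl i') k (by omega)))
    exact Nice.congr r this fun G U => BF_base r β s t mv p q x y hl k hk1 hk i i' G U
  | succ j hkj ih =>
    have := (((pnice_zeta r β s t mv p q x y hl j (by omega)).rpow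
      (mv (j+1) / mv j - 1)).nice.mul (ih (by omega))).II ⟨j, by omega⟩
    exact Nice.congr r this fun G U => BF_succ r β s t mv p q x y hl k j hkj (by omega) i i' G U

lemma key_level (hl : 1 ≤ l) (hm0 : mv 0 = 1) (hmpos : ∀ k, 1 ≤ k → k ≤ r → 0 < mv k)
    (ha : ∀ k ≤ r, acoef p q k ≠ 0) (i : Fin l × Fin l) (k : ℕ) (hk : k + 1 ≤ r)
    (G : GM m n) (U : UU r m n) :
    (acoef p q (k+1))⁻¹ * νF (fun G U => gF r β s t mv p q x y i G U * u4c U (k+1+1)) (k+2) G U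
      - (acoef p q k)⁻¹ * νF (fun G U => gF r β s t mv p q x y i G U * u4c U (k+1)) (k+2) G U
    = β * √t * s * (mv (k+2) - mv (k+1)) *
        ∑ i', dF x y i' * BF r β s t mv p q x y (k+1) (k+2) i i' G U := by
  have h0 : k < r + 1 := by omega
  have h1 : k + 1 < r + 1 := by omega
  obtain ⟨g', hg'⟩ := DD_nest r β s t mv p q x y hl hm0 hmpos i k (by omega)
  have pz0 := pnice_zeta r β s t mv p q x y hl k (by omega)
  have pz1 := pnice_zeta r β s t mv p q x y hl (k+1) (by omega)
  have hH := ((DD_zeta r β s t mv p q x y hl hm0 hmpos k (by omega)).rpow pz0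
      (mv (k+1) / mv k - 1)).mul hg'
  set H' := (fun (G : GM m n) (U : UU r m n) => _ + _ : GM m n → UU r m n → ℝ) with hH'
  have hN : DD (acoef p q) (k+1) (fun G U => νF (gF r β s t mv p q x y i) (k+1) G U)
      (II ⟨k, h0⟩ H') :=
    (DD.II ⟨k, h0⟩ hH).congr (fun G U => nest_succ r β s t mv p q x y _ h0 G U) fun G U => rfl
  have hQ := ((DD_zeta r β s t mv p q x y hl hm0 hmpos (k+1) (by omega)).rpow pz1
      (mv (k+2) / mv (k+1) - 1)).mul hN
  have nB : ∀ i', Nice (BF r β s t mv p q x y (k+1) (k+1) i i') := fun i' =>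
    nice_BF r β s t mv p q x y hl (k+1) (by omega) hk i i' (k+1) le_rfl (by omega)
  have nBz : ∀ i', Nice (fun G U => zetaR r 1 β s t mv p q x y G (k+1) U ^
      (mv (k+2) / mv (k+1) - 1) * BF r β s t mv p q x y (k+1) (k+1) i i' G U) := fun i' =>
    (pz1.rpow _).nice.mul (nB i')
  -- the lower term
  have L1 : ∀ G U, νF (fun G U => gF r β s t mv p q x y i G U * u4c U (k+1)) (k+1) G U
      = acoef p q k * II ⟨k, h0⟩ H' G U := by
    intro G U
    rw [nest_succ r β s t mv p q x y _ h0]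
    have := hH.stein ⟨k, h0⟩ le_rfl G U
    rw [← this]
    refine congrFun (congrFun (II_congr _ fun G U => ?_) G) U
    rw [nest_u4 r β s t mv p q x y _ k h0 k le_rfl, mul_assoc]
  have L2 : νF (fun G U => gF r β s t mv p q x y i G U * u4c U (k+1)) (k+2) G U
      = acoef p q k * II ⟨k+1, h1⟩ (fun G U => zetaR r 1 β s t mv p q x y G (k+1) U ^
        (mv (k+2) / mv (k+1) - 1) * II ⟨k, h0⟩ H' G U) G U := by
    rw [nest_succ r β s t mv p q x y _ h1, ← II_const_mul]
    refine congrFun (congrFun (II_congr _ fun G U => ?_) G) U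
    rw [L1]; ring
  -- the upper term
  have L3 : νF (fun G U => gF r β s t mv p q x y i G U * u4c U (k+1+1)) (k+2) G U
      = acoef p q (k+1) * (β * √t * s * (mv (k+2) - mv (k+1)) *
        ∑ i', dF x y i' * BF r β s t mv p q x y (k+1) (k+2) i i' G U +
        II ⟨k+1, h1⟩ (fun G U => zetaR r 1 β s t mv p q x y G (k+1) U ^
        (mv (k+2) / mv (k+1) - 1) * II ⟨k, h0⟩ H' G U) G U) := by
    have hst := hQ.stein ⟨k+1, h1⟩ le_rfl G U
    rw [nest_succ r β s t mv p q x y _ h1]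
    have e1 : II ⟨k+1, h1⟩ (fun G U => zetaR r 1 β s t mv p q x y G (k+1) U ^
        (mv (k+1+1) / mv (k+1) - 1) *
        νF (fun G U => gF r β s t mv p q x y i G U * u4c U (k+1+1)) (k+1) G U) G U = _ :=
      (congrFun (congrFun (II_congr _ fun G U => by
        rw [nest_u4 r β s t mv p q x y _ (k+1) h1 (k+1) le_rfl, mul_assoc]) G) U).trans hst
    rw [e1]
    congr 1
    have hs : ∑ i', dF x y i' * BF r β s t mv p q x y (k+1) (k+2) i i' G U =
        II ⟨k+1, h1⟩ (fun G U => ∑ i', dF x y i' * (zetaR r 1 β s t mv p q x y G (k+1) U ^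
          (mv (k+2) / mv (k+1) - 1) * BF r β s t mv p q x y (k+1) (k+1) i i' G U)) G U := by
      rw [II_sum _ _ (fun i' => (nBz i').const_mul (dF x y i'))]
      refine Finset.sum_congr rfl fun i' _ => ?_
      rw [BF_succ r β s t mv p q x y hl (k+1) (k+1) le_rfl h1, II_const_mul]
    rw [hs, ← II_const_mul,
      ← II_add _ ((Nice.sum _ (fun i' => (nBz i').const_mul (dF x y i'))).const_mul _)
        ((pz1.rpow _).nice.mul (hH.nf'.II _))]
    refine congrFun (congrFun (II_congr _ fun G U => ?_) G) U
    congr 1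
    have hz := (pz1.pos G U).ne'
    have hmk : mv (k+1) ≠ 0 := (hmpos (k+1) (by omega) hk).ne'
    simp only [BF_base r β s t mv p q x y hl (k+1) (by omega) hk]
    rw [Real.rpow_sub_one hz]
    simp only [Finset.mul_sum, Finset.sum_mul]
    refine Finset.sum_congr rfl fun i' _ => ?_
    field_simp
  rw [L2, L3, inv_mul_cancel_left₀ (ha (k+1) hk), inv_mul_cancel_left₀ (ha k (by omega))]
  ring

lemma key_levels (hl : 1 ≤ l) (hm0 : mv 0 = 1) (hmpos : ∀ k, 1 ≤ k → k ≤ r → 0 < mv k)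
    (ha : ∀ k ≤ r, acoef p q k ≠ 0) (i : Fin l × Fin l) (k : ℕ) (hk : k + 1 ≤ r)
    (j : ℕ) (hkj : k + 2 ≤ j) (hj : j ≤ r + 1) (G : GM m n) (U : UU r m n) :
    (acoef p q (k+1))⁻¹ * νF (fun G U => gF r β s t mv p q x y i G U * u4c U (k+1+1)) j G U
      - (acoef p q k)⁻¹ * νF (fun G U => gF r β s t mv p q x y i G U * u4c U (k+1)) j G U
    = β * √t * s * (mv (k+2) - mv (k+1)) *
        ∑ i', dF x y i' * BF r β s t mv p q x y (k+1) j i i' G U := by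
  induction j, hkj using Nat.le_induction generalizing G U with
  | base => exact key_level r β s t mv p q x y hl hm0 hmpos ha i k hk G U
  | succ j hkj ih =>
    have hj' : j < r + 1 := by omega
    have pz := pnice_zeta r β s t mv p q x y hl j (by omega)
    have n1 := (pz.rpow (mv (j+1) / mv j - 1)).nice.mul (nice_nest r β s t mv p q x y hl
      (nice_gu r β s t mv p q x y hl i (k+1) (by omega)) j (by omega))
    have n2 := (pz.rpow (mv (j+1) / mv j - 1)).nice.mul (nice_nest r β s t mv p q x y hl
      (nice_gu r β s t mv p q x y hl i k (by omega)) j (by omega))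
    have nBz : ∀ i', Nice (fun G U => zetaR r 1 β s t mv p q x y G j U ^
        (mv (j+1) / mv j - 1) * BF r β s t mv p q x y (k+1) j i i' G U) := fun i' =>
      (pz.rpow _).nice.mul
        (nice_BF r β s t mv p q x y hl (k+1) (by omega) hk i i' j (by omega) (by omega))
    simp only [BF_succ r β s t mv p q x y hl (k+1) j (by omega) hj']
    rw [nest_succ r β s t mv p q x y _ hj', nest_succ r β s t mv p q x y _ hj']
    simp only [← II_const_mul]
    rw [← II_sum _ _ (fun i' => (nBz i').const_mul (dF x y i')), ← II_const_mul,
      ← II_sub _ (n1.const_mul _) (n2.const_mul _)]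
    refine congrFun (congrFun (II_congr _ fun G U => ?_) G) U
    have := ih (by omega) G U
    calc _ = zetaR r 1 β s t mv p q x y G j U ^ (mv (j+1) / mv j - 1) *
          (β * √t * s * (mv (k+2) - mv (k+1)) *
            ∑ i', dF x y i' * BF r β s t mv p q x y (k+1) j i i' G U) := by
          rw [← this]; ring
      _ = _ := by
          simp only [Finset.mul_sum]
          refine Finset.sum_congr rfl fun i' _ => ?_
          ring

lemma last_level (hl : 1 ≤ l) (hmr1 : mv (r+1) = 0) {F : GM m n → UU r m n → ℝ} (hF : Nice F) :
    ∫ ω, (zetaR r 1 β s t mv p q x y ω.1 r ω.2)⁻¹ * F ω.1 ω.2 ∂ muAll r m n =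
    ∫ ω, II ⟨r, by omega⟩ (fun G U => zetaR r 1 β s t mv p q x y G r U ^ (mv (r+1) / mv r - 1)
      * F G U) ω.1 ω.2 ∂ muAll r m n := by
  have pz := pnice_zeta r β s t mv p q x y hl r (by omega)
  rw [integral_II _ ((pz.rpow _).nice.mul hF)]
  refine integral_congr_ae (ae_of_all _ fun ω => ?_)
  simp only [hmr1, zero_div, zero_sub]
  rw [Real.rpow_neg_one]

lemma T_eq (hl : 1 ≤ l) (hmr1 : mv (r+1) = 0) (i : Fin l × Fin l) (c : ℕ) (hc : c < r + 1) :
    TpqR r 1 β s t mv p q x y (c+1) i.1 i.2 =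
      ∫ ω, νF (fun G U => gF r β s t mv p q x y i G U * u4c U (c+1)) (r+1) ω.1 ω.2
        ∂ muAll r m n := by
  have := last_level r β s t mv p q x y hl hmr1 (nice_nest r β s t mv p q x y hl
    (nice_gu r β s t mv p q x y hl i c hc) r (by omega))
  simp only [nest_succ r β s t mv p q x y _ (show r < r + 1 by omega)]
  exact this

lemma gam_eq (hl : 1 ≤ l) (hmr1 : mv (r+1) = 0) (k : ℕ) (hk1 : 1 ≤ k) (hk : k ≤ r)
    (i i' : Fin l × Fin l) :
    ∫ ω, BF r β s t mv p q x y k (r+1) i i' ω.1 ω.2 ∂ muAll r m n =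
      ∫ ω, gamR r 1 β s t mv p q x y k i.1 i.2 i'.1 i'.2 ω.1 ω.2 ∂ muAll r m n := by
  have := last_level r β s t mv p q x y hl hmr1
    (nice_BF r β s t mv p q x y hl k hk1 hk i i' r hk (by omega))
  simp only [BF_succ r β s t mv p q x y hl k r hk (show r < r + 1 by omega)]
  rw [← this]
  refine integral_congr_ae (ae_of_all _ fun ω => ?_)
  simp only [BF]
  rw [inv_mul_cancel_left₀ ((pnice_zeta r β s t mv p q x y hl r (by omega)).pos _ _).ne']
  rfl

lemma gam_int (hl : 1 ≤ l) (k : ℕ) (hk1 : 1 ≤ k) (hk : k ≤ r)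
    (i i' : Fin l × Fin l) :
    Integrable (fun ω : GM m n × UU r m n =>
      gamR r 1 β s t mv p q x y k i.1 i.2 i'.1 i'.2 ω.1 ω.2) (muAll r m n) := by
  have := ((pnice_zeta r β s t mv p q x y hl r (by omega)).inv.nice.mul
    (nice_BF r β s t mv p q x y hl k hk1 hk i i' r hk (by omega))).integrable_all
  refine this.congr (ae_of_all _ fun ω => ?_)
  simp only [BF]
  rw [inv_mul_cancel_left₀ ((pnice_zeta r β s t mv p q x y hl r (by omega)).pos _ _).ne']
  rfl

lemma T_diff (hl : 1 ≤ l) (hm0 : mv 0 = 1) (hmr1 : mv (r+1) = 0)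
    (hmpos : ∀ k, 1 ≤ k → k ≤ r → 0 < mv k)
    (ha : ∀ k ≤ r, acoef p q k ≠ 0) (i : Fin l × Fin l) (k : ℕ) (hk : k + 1 ≤ r) :
    (acoef p q (k+1))⁻¹ * TpqR r 1 β s t mv p q x y (k+1+1) i.1 i.2
      - (acoef p q k)⁻¹ * TpqR r 1 β s t mv p q x y (k+1) i.1 i.2
    = β * √t * s * (mv (k+2) - mv (k+1)) *
        ∑ i' : Fin l × Fin l, dF x y i' *
          ∫ ω, gamR r 1 β s t mv p q x y (k+1) i.1 i.2 i'.1 i'.2 ω.1 ω.2 ∂ muAll r m n := by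
  rw [T_eq r β s t mv p q x y hl hmr1 i (k+1) (by omega),
    T_eq r β s t mv p q x y hl hmr1 i k (by omega)]
  simp only [← gam_eq r β s t mv p q x y hl hmr1 (k+1) (by omega) hk]
  have n1 := (nice_nest r β s t mv p q x y hl
      (nice_gu r β s t mv p q x y hl i (k+1) (by omega)) (r+1) le_rfl).integrable_all
  have n2 := (nice_nest r β s t mv p q x y hl
      (nice_gu r β s t mv p q x y hl i k (by omega)) (r+1) le_rfl).integrable_all
  have nB := fun i' => (nice_BF r β s t mv p q x y hl (k+1) (by omega) hk i i' (r+1)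
    (by omega) le_rfl).integrable_all
  simp only [← integral_const_mul]
  rw [← integral_finsetSum _ (fun i' _ => (nB i').const_mul (dF x y i')), ← integral_const_mul,
    ← integral_sub (n1.const_mul _) (n2.const_mul _)]
  refine integral_congr_ae (ae_of_all _ fun ω => ?_)
  exact key_levels r β s t mv p q x y hl hm0 hmpos ha i k hk (r+1) (by omega) le_rfl ω.1 ω.2

lemma EBr_eq (hl : 1 ≤ l) (k : ℕ) (hk1 : 1 ≤ k) (hk : k ≤ r) :
    EBrR r 1 β s t mv p q x y k (fun i1 i2 pp1 pp2 =>
      nrm2 (x i1) * nrm2 (x pp1) * nrm2 (y i2) * nrm2 (y pp2)) =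
    ∑ i : Fin l × Fin l, ∑ i' : Fin l × Fin l, dF x y i * dF x y i' *
      ∫ ω, gamR r 1 β s t mv p q x y k i.1 i.2 i'.1 i'.2 ω.1 ω.2 ∂ muAll r m n := by
  have hi := gam_int r β s t mv p q x y hl k hk1 hk
  simp only [← integral_const_mul]
  have e : ∀ i : Fin l × Fin l, ∑ i' : Fin l × Fin l,
      ∫ ω, dF x y i * dF x y i' * gamR r 1 β s t mv p q x y k i.1 i.2 i'.1 i'.2 ω.1 ω.2
        ∂ muAll r m n = ∫ ω, ∑ i' : Fin l × Fin l,
      dF x y i * dF x y i' * gamR r 1 β s t mv p q x y k i.1 i.2 i'.1 i'.2 ω.1 ω.2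
        ∂ muAll r m n := fun i =>
    (integral_finsetSum _ (fun i' _ => (hi i i').const_mul _)).symm
  simp only [e]
  rw [← integral_finsetSum _
    (fun i _ => integrable_finsetSum _ fun i' _ => (hi i i').const_mul _)]
  unfold EBrR
  refine integral_congr_ae (ae_of_all _ fun ω => ?_)
  simp only [Fintype.sum_prod_type, dF]
  refine Finset.sum_congr rfl fun i1 _ => Finset.sum_congr rfl fun i2 _ =>
    Finset.sum_congr rfl fun j1 _ => Finset.sum_congr rfl fun j2 _ => ?_
  ring

end concrete

/-- `r`-th level scaled-cancellation recursion for the sequence `T^{(p,q)}_{k,3}`. -/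
theorem rth_level_recursion_Tpq
    (r m n l : ℕ) (hr : 1 ≤ r) (hm : 1 ≤ m) (hn : 1 ≤ n) (hl : 1 ≤ l)
    (β s t : ℝ) (hβ : 0 < β) (hs : s ≠ 0) (ht : t ∈ Set.Ioo (0:ℝ) 1)
    (mv p q : ℕ → ℝ)
    (hm0 : mv 0 = 1) (hmr1 : mv (r+1) = 0) (hmpos : ∀ k, 1 ≤ k → k ≤ r → 0 < mv k)
    (hp0 : p 0 ≤ 1) (hpmono : ∀ k ≤ r, p (k+1) ≤ p k) (hpend : p (r+1) = 0)
    (hq0 : q 0 ≤ 1) (hqmono : ∀ k ≤ r, q (k+1) ≤ q k) (hqend : q (r+1) = 0)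
    (x : Fin l → Fin n → ℝ) (y : Fin l → Fin m → ℝ)
    (hx : ∀ i, x i ≠ 0) (hy : ∀ i, y i ≠ 0)
    (hpqstrict : ∀ k ≤ r, p (k+1) * q (k+1) < p k * q k) :
    ∀ k1, 1 ≤ k1 → k1 ≤ r →
      (∑ i1, ∑ i2, β * nrm2 (x i1) * nrm2 (y i2) *
          (Real.sqrt t / Real.sqrt (p k1 * q k1 - p (k1+1) * q (k1+1)) *
            TpqR r 1 β s t mv p q x y (k1+1) i1 i2))
        = (∑ i1, ∑ i2, β * nrm2 (x i1) * nrm2 (y i2) *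
            (Real.sqrt t / Real.sqrt (p (k1-1) * q (k1-1) - p k1 * q k1) *
              TpqR r 1 β s t mv p q x y k1 i1 i2))
          - t * s * β ^ 2 * (mv k1 - mv (k1+1)) * EBrR r 1 β s t mv p q x y k1 (fun i1 i2 pp1 pp2 => nrm2 (x i1) * nrm2 (x pp1) * nrm2 (y i2) * nrm2 (y pp2)) := by
  intro k1 hk1 hkr
  obtain ⟨k, rfl⟩ : ∃ k, k1 = k + 1 := ⟨k1 - 1, by omega⟩
  have ha : ∀ k ≤ r, acoef p q k ≠ 0 := fun k hk =>
    (Real.sqrt_pos.2 (sub_pos.2 (hpqstrict k hk))).ne'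
  have hT := fun i => T_diff r β s t mv p q x y hl hm0 hmr1 hmpos ha i k hkr
  rw [EBr_eq r β s t mv p q x y hl (k+1) hk1 hkr, Fintype.sum_prod_type, Finset.mul_sum,
    ← Finset.sum_sub_distrib]
  refine Finset.sum_congr rfl fun i1 _ => ?_
  rw [Finset.mul_sum, ← Finset.sum_sub_distrib]
  refine Finset.sum_congr rfl fun i2 _ => ?_
  have h := hT (i1, i2)
  have hS : ∑ i' : Fin l × Fin l, dF x y (i1, i2) * dF x y i' *
      ∫ ω, gamR r 1 β s t mv p q x y (k+1) i1 i2 i'.1 i'.2 ω.1 ω.2 ∂ muAll r m n =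
      dF x y (i1, i2) * ∑ i' : Fin l × Fin l, dF x y i' *
      ∫ ω, gamR r 1 β s t mv p q x y (k+1) i1 i2 i'.1 i'.2 ω.1 ω.2 ∂ muAll r m n := by
    rw [Finset.mul_sum]
    exact Finset.sum_congr rfl fun i' _ => by ring
  simp only at h ⊢
  rw [hS]
  generalize (∑ i' : Fin l × Fin l, dF x y i' *
      ∫ ω, gamR r 1 β s t mv p q x y (k+1) i1 i2 i'.1 i'.2 ω.1 ω.2 ∂ muAll r m n) = S at h ⊢
  have htt : √t * √t = t := Real.mul_self_sqrt ht.1.le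
  simp only [Nat.add_sub_cancel]
  change β * nrm2 (x i1) * nrm2 (y i2) * (√t / acoef p q (k+1) * _) =
    β * nrm2 (x i1) * nrm2 (y i2) * (√t / acoef p q k * _) - _
  rw [sub_eq_iff_eq_add] at h
  rw [div_mul_eq_mul_div, div_mul_eq_mul_div, div_eq_inv_mul, div_eq_inv_mul]
  rw [mul_left_comm (acoef p q (k+1))⁻¹, h]
  simp only [dF]
  linear_combination (β ^ 2 * nrm2 (x i1) * nrm2 (y i2) * s * (mv (k+2) - mv (k+1)) * S) * htt

end

end SFLR
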